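/- If u is an admissible monomial of degree 67 in P_5 in which every variable occurs with positive exponent and S_5(u) is hit, then the weight vector ω(u) is one of the three sequences (3,4,2,2,2), (3,4,4,3,1), (3,2,1,1,1,1) (each followed by zeros). -/

import Mathlib

open MvPolynomial

noncomputable section

/-- `P n` is the polynomial algebra `𝔽₂[x_1, …, x_n]`. -/
abbrev P (n : ℕ) : Type := MvPolynomial (Fin n) (ZMod 2)

/-- The total Steenrod square: the `𝔽₂`-algebra endomorphism of `P n`
with `Sq (x_j) = x_j + x_j ^ 2`. -/
def SqT (n : ℕ) : P n →ₐ[ZMod 2] P n := aeval fun j => X j + X j ^ 2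

/-- `u` is hit (in degree `d`): `u = ∑_{i ≥ 1} Sq^i (f i)` where `f i` is homogeneous
of degree `d - i`; here `Sq^i (f i)` is the degree-`d` homogeneous component of
`Sq (f i)`. -/
def IsHit (n d : ℕ) (u : P n) : Prop :=
  ∃ f : ℕ → P n,
    (∀ i, f i ∈ homogeneousSubmodule (Fin n) (ZMod 2) (d - i)) ∧
    u = ∑ i ∈ Finset.Icc 1 d, homogeneousComponent d (SqT n (f i))

/-- The homogeneous part `(P_n)_d`. -/
abbrev homSub (n d : ℕ) : Submodule (ZMod 2) (P n) := homogeneousSubmodule (Fin n) (ZMod 2) d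

/-- The subspace of hit elements of degree `d` (the span of the set of hit elements;
this set is already closed under addition, so this is just the set of hit elements). -/
def hitSub (n d : ℕ) : Submodule (ZMod 2) (P n) := Submodule.span (ZMod 2) {u | IsHit n d u}

/-- The cohit space `(QP_n)_d = (P_n)_d / (A⁺P_n)_d`. -/
abbrev QP (n d : ℕ) : Type :=
  ↥(homSub n d) ⧸ (hitSub n d).comap (homSub n d).subtype

/-- The class `[f]` in `(QP_n)_d` of a polynomial `f` (via its degree-`d` homogeneous
component; for `f` homogeneous of degree `d` this is the class of `f` itself). -/
def cls (n d : ℕ) (f : P n) : QP n d :=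
  Submodule.Quotient.mk
    ⟨homogeneousComponent d f,
      (mem_homogeneousSubmodule _ _).2 (homogeneousComponent_isHomogeneous d f)⟩

/-- The monomial `x^a = x_1^{a_1} ⋯ x_n^{a_n}`. -/
def mono {n : ℕ} (a : Fin n →₀ ℕ) : P n := monomial a 1

/-- The (total) degree of the monomial with exponent vector `a`. -/
def degA {n : ℕ} (a : Fin n →₀ ℕ) : ℕ := ∑ i, a i

/-- The weight vector: `wVec a t = ω_{t+1}(x^a) = ∑_j α_t(a_j)`. -/
def wVec {n : ℕ} (a : Fin n →₀ ℕ) : ℕ → ℕ :=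
  fun t => ∑ j, if Nat.testBit (a j) t then 1 else 0

/-- Left lexicographic (strict) order on sequences. -/
def lexLtN (f g : ℕ → ℕ) : Prop := ∃ i, (∀ j, j < i → f j = g j) ∧ f i < g i

/-- Left lexicographic (strict) order on exponent vectors. -/
def lexLtS {n : ℕ} (a b : Fin n →₀ ℕ) : Prop :=
  ∃ i : Fin n, (∀ j, j < i → a j = b j) ∧ a i < b i

/-- The order on monomials: `u < v` iff `ω(u) < ω(v)` lexicographically, or
`ω(u) = ω(v)` and `σ(u) < σ(v)` lexicographically. -/
def monLt {n : ℕ} (a b : Fin n →₀ ℕ) : Prop :=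
  lexLtN (wVec a) (wVec b) ∨ (wVec a = wVec b ∧ lexLtS a b)

/-- A monomial is admissible iff it is not inadmissible, i.e. there is no finite set of
monomials of the same degree, all smaller than it, such that subtracting their sum
yields a hit polynomial. -/
def Admissible {n : ℕ} (a : Fin n →₀ ℕ) : Prop :=
  ¬ ∃ S : Finset (Fin n →₀ ℕ),
      (∀ b ∈ S, degA b = degA a ∧ monLt b a) ∧
      IsHit n (degA a) (mono a - ∑ b ∈ S, mono b)

/-- `P_n^0`: the span of the monomials in which some variable has exponent `0`. -/
def PzeroSub (n : ℕ) : Submodule (ZMod 2) (P n) :=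
  Submodule.span (ZMod 2) {x : P n | ∃ a : Fin n →₀ ℕ, (∃ i, a i = 0) ∧ x = mono a}

/-- `P_n^+`: the span of the monomials in which every variable occurs. -/
def PplusSub (n : ℕ) : Submodule (ZMod 2) (P n) :=
  Submodule.span (ZMod 2) {x : P n | ∃ a : Fin n →₀ ℕ, (∀ i, 0 < a i) ∧ x = mono a}

/-- `(QP_n^0)_d`: the image of `(P_n^0)_d` in `(QP_n)_d`. -/
def Qzero (n d : ℕ) : Submodule (ZMod 2) (QP n d) :=
  (((PzeroSub n).comap (homSub n d).subtype)).map
    ((hitSub n d).comap (homSub n d).subtype).mkQ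

/-- `(QP_n^+)_d`: the image of `(P_n^+)_d` in `(QP_n)_d`. -/
def Qplus (n d : ℕ) : Submodule (ZMod 2) (QP n d) :=
  (((PplusSub n).comap (homSub n d).subtype)).map
    ((hitSub n d).comap (homSub n d).subtype).mkQ

/-- Kameko-type map `S_5 : P_5 → P_5`, the `𝔽₂`-linear map with
`S_5(x_1x_2x_3x_4x_5 · y²) = y` on monomials of that form and `S_5 = 0` on all
other monomials. -/
def S5 : P 5 →ₗ[ZMod 2] P 5 :=
  (basisMonomials (Fin 5) (ZMod 2)).constr (ZMod 2) fun a =>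
    if ∀ i, Odd (a i) then mono (Finsupp.equivFunOnFinite.symm fun i => a i / 2) else 0

/-- `Φ(f) = x_1x_2x_3x_4x_5 · f²`. -/
def Phi (f : P 5) : P 5 := (∏ i : Fin 5, X i) * f ^ 2


/-! ### List combinatorics used by the certificate checker -/

/-- `subs n a` lists the `j` whose binary digits are contained in those of `a` (`a ≤ n`). -/
def subs : ℕ → ℕ → List ℕ
  | 0, _ => [0]
  | n + 1, a => bif Nat.beq a 0 then [0] else
      bif Nat.beq (a % 2) 1 then (subs n (a / 2)).flatMap (fun j => [2 * j, 2 * j + 1])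
      else (subs n (a / 2)).map (fun j => 2 * j)

theorem list_sq {R : Type*} [CommRing R] [CharP R 2] (l : List R) :
    l.sum ^ 2 = (l.map (· ^ 2)).sum := by
  have := map_list_sum (frobenius R 2) l
  simp only [frobenius_def] at this
  rw [this]; rfl

theorem subs_spec {R : Type*} [CommRing R] [CharP R 2] (x : R) (n : ℕ) :
    ∀ a, a ≤ n → (x + x ^ 2) ^ a = ((subs n a).map (fun j => x ^ (a + j))).sum := by
  induction n with
  | zero => intro a ha; obtain rfl : a = 0 := by omega
            simp [subs]
  | succ n ih =>
    intro a ha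
    rcases Nat.eq_zero_or_pos a with rfl | hpos
    · simp [subs]
    have h0 : Nat.beq a 0 = false := by
      rw [Bool.eq_false_iff]; intro h; have := Nat.eq_of_beq_eq_true h; omega
    have key := congrArg (· ^ 2) (ih (a / 2) (by omega))
    simp only [list_sq, List.map_map, ← pow_mul] at key
    rcases Nat.mod_two_eq_zero_or_one a with h | h
    · have ha2 : a = a / 2 * 2 := by omega
      simp only [subs, h0, h, cond_false]
      rw [show Nat.beq 0 1 = false from rfl, cond_false, List.map_map]
      conv_lhs => rw [ha2]
      rw [key]
      congr 1
      apply List.map_congr_left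
      intro j _
      simp only [Function.comp, ← pow_mul]
      congr 1; omega
    · have ha2 : a = a / 2 * 2 + 1 := by omega
      simp only [subs, h0, h, cond_false]
      rw [show Nat.beq 1 1 = true from rfl, cond_true]
      conv_lhs => rw [ha2, pow_succ, key]
      rw [List.map_flatMap, List.flatMap, List.sum_flatten, List.map_map, ← List.sum_map_mul_right]
      congr 1
      apply List.map_congr_left
      intro j _
      simp only [Function.comp, ← pow_mul, List.map_cons, List.map_nil, List.sum_cons, List.sum_nil,
        mul_add, ← pow_succ, ← pow_add, add_zero]
      congr 2 <;> omega

def goAll : List ℕ → List (List ℕ)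
  | [] => [[]]
  | a :: as => (subs a a).flatMap (fun j => (goAll as).map (fun m => (a + j) :: m))

def goS : List ℕ → ℕ → List (List ℕ)
  | [], s => bif Nat.beq s 0 then [[]] else []
  | a :: as, s => (subs a a).flatMap (fun j =>
      bif Nat.ble j s then (goS as (s - j)).map (fun m => (a + j) :: m) else [])

theorem sum_flatMap_map {α β M : Type*} [AddCommMonoid M] (l : List α) (g : α → List β)
    (φ : β → M) : ((l.flatMap g).map φ).sum = (l.map (fun j => ((g j).map φ).sum)).sum := by
  induction l with
  | nil => simp
  | cons a l ih => simp [List.flatMap_cons, ih]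

theorem goAll_ge (as : List ℕ) : ∀ m ∈ goAll as, as.sum ≤ m.sum := by
  induction as with
  | nil => simp [goAll]
  | cons a as ih =>
    intro m hm
    simp only [goAll, List.mem_flatMap, List.mem_map] at hm
    obtain ⟨j, _, m', hm', rfl⟩ := hm
    have := ih m' hm'
    simp; omega

theorem goS_length (as : List ℕ) : ∀ s, ∀ m ∈ goS as s, m.length = as.length := by
  induction as with
  | nil => intro s m hm; cases h : Nat.beq s 0 <;> simp_all [goS]
  | cons a as ih =>
    intro s m hm
    simp only [goS, List.mem_flatMap] at hm
    obtain ⟨j, _, hm⟩ := hm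
    cases h : Nat.ble j s
    · simp [h] at hm
    · simp only [h, cond_true, List.mem_map] at hm
      obtain ⟨m', hm', rfl⟩ := hm
      simp [ih _ m' hm']

theorem goS_spec {M : Type*} [AddCommMonoid M] (as : List ℕ) : ∀ (φ : List ℕ → M) (s : ℕ),
    ((goS as s).map φ).sum =
      ((goAll as).map (fun m => if m.sum = as.sum + s then φ m else 0)).sum := by
  induction as with
  | nil =>
    intro φ s
    rcases Nat.eq_zero_or_pos s with rfl | h
    · simp [goS, goAll]
    · have h0 : Nat.beq s 0 = false := by
        rw [Bool.eq_false_iff]; intro h; have := Nat.eq_of_beq_eq_true h; omega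
      have : ¬ (0 = s) := by omega
      simp [goS, goAll, h0, this]
  | cons a as ih =>
    intro φ s
    simp only [goS, goAll, sum_flatMap_map]
    congr 1
    apply List.map_congr_left
    intro j _
    cases h : Nat.ble j s
    · have hj : s < j := by
        by_contra hc
        rw [Nat.ble_eq_true_of_le (by omega)] at h; cases h
      simp only [cond_false, List.map_nil, List.sum_nil, List.map_map]
      symm
      apply List.sum_eq_zero
      intro x hx
      simp only [List.mem_map] at hx
      obtain ⟨m, hm, rfl⟩ := hx
      have := goAll_ge as m hm
      exact if_neg (by simp only [List.sum_cons]; omega)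
    · have hj : j ≤ s := Nat.le_of_ble_eq_true h
      simp only [cond_true, List.map_map, ih]
      congr 1
      apply List.map_congr_left
      intro m _
      by_cases hc : m.sum = as.sum + (s - j)
      · rw [if_pos hc]
        exact (if_pos (by simp only [List.sum_cons]; omega)).symm
      · rw [if_neg hc]
        exact (if_neg (by simp only [List.sum_cons]; omega)).symm

theorem goAll_prod {R : Type*} [CommRing R] [CharP R 2] (as : List ℕ) : ∀ vs : List R,
    (List.zipWith (fun v a => (v + v ^ 2) ^ a) vs as).prod =
      if vs.length < as.length then (List.zipWith (fun v a => (v + v ^ 2) ^ a) vs as).prod else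
      ((goAll as).map (fun m => (List.zipWith (fun v a => v ^ a) vs m).prod)).sum := by
  induction as with
  | nil => intro vs; simp [goAll]
  | cons a as ih =>
    intro vs
    cases vs with
    | nil => simp
    | cons v vs =>
      split_ifs with h
      · rfl
      · have hi := ih vs
        rw [if_neg (by simpa using h)] at hi
        rw [List.zipWith_cons_cons, List.prod_cons, hi, subs_spec v a a le_rfl]
        simp only [goAll, sum_flatMap_map, List.map_map]
        rw [← List.sum_map_mul_right]
        congr 1
        apply List.map_congr_left
        intro j _
        rw [← List.sum_map_mul_left]
        congr 1

/-- The exponent vector attached to a list. -/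
def toF (m : List ℕ) : Fin 5 →₀ ℕ := Finsupp.equivFunOnFinite.symm (fun i => m.getD i 0)

theorem toF_apply (m : List ℕ) (i : Fin 5) : toF m i = m.getD i 0 := rfl

theorem degA_toF (m : List ℕ) (h : m.length = 5) : degA (toF m) = m.sum := by
  match m, h with
  | [a, b, c, d, e], _ => simp [degA, toF_apply, Fin.sum_univ_five]; ring

theorem mono_eq_prod {n : ℕ} (a : Fin n →₀ ℕ) : mono a = ∏ i, (X i : P n) ^ a i := by
  rw [mono, monomial_eq, C_1, one_mul, Finsupp.prod_fintype]
  simp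

theorem SqT_mono {n : ℕ} (a : Fin n →₀ ℕ) :
    SqT n (mono a) = ∏ i, (X i + X i ^ 2 : P n) ^ a i := by
  rw [mono_eq_prod, map_prod]; simp [SqT]

theorem degree_eq {n : ℕ} (a : Fin n →₀ ℕ) : a.degree = degA a := by
  rw [degA, Finsupp.degree_eq_sum]

theorem hc_mono {n : ℕ} (d : ℕ) (a : Fin n →₀ ℕ) :
    homogeneousComponent d (mono a) = if degA a = d then mono a else 0 := by
  have : mono a ∈ homogeneousSubmodule (Fin n) (ZMod 2) (degA a) := by
    rw [mem_homogeneousSubmodule, mono]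
    exact isHomogeneous_monomial _ (degree_eq a)
  rw [homogeneousComponent_of_mem this]
  simp [eq_comm]

theorem hc_SqT_list (f : List ℕ) (hf : f.length = 5) (d : ℕ) (hd : f.sum ≤ d) :
    homogeneousComponent d (SqT 5 (mono (toF f))) =
      ((goS f (d - f.sum)).map (fun m => mono (toF m))).sum := by
  have h1 : SqT 5 (mono (toF f)) = ((goAll f).map (fun m => if m.length = 5 then (mono (toF m) : P 5) else 0)).sum := by
    have := goAll_prod f [(X 0 : P 5), X 1, X 2, X 3, X 4]
    rw [if_neg (by simp [hf])] at this
    match f, hf with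
    | [a, b, c, d, e], _ =>
      rw [SqT_mono]
      trans ((List.zipWith (fun v a => (v + v ^ 2) ^ a) [(X 0 : P 5), X 1, X 2, X 3, X 4] [a, b, c, d, e]).prod)
      · simp [Fin.prod_univ_five, toF_apply, mul_assoc]
      rw [this]
      congr 1
      apply List.map_congr_left
      intro m hm
      have hl : m.length = 5 := by
        simp only [goAll, List.mem_flatMap, List.mem_map, List.mem_singleton] at hm
        obtain ⟨_, _, _, ⟨_, _, _, ⟨_, _, _, ⟨_, _, _, ⟨_, _, _, rfl, rfl⟩, rfl⟩, rfl⟩, rfl⟩, rfl⟩ := hm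
        rfl
      rw [if_pos hl]
      match m, hl with
      | [a, b, c, d, e], _ => simp [mono_eq_prod, Fin.prod_univ_five, toF_apply, mul_assoc]
  rw [h1, map_list_sum, List.map_map]
  have h2 := goS_spec f (fun m => if m.length = 5 then (mono (toF m) : P 5) else 0) (d - f.sum)
  rw [show f.sum + (d - f.sum) = d by omega] at h2
  trans ((goS f (d - f.sum)).map (fun m => if m.length = 5 then (mono (toF m) : P 5) else 0)).sum
  · rw [h2]
    congr 1
    apply List.map_congr_left
    intro m hm
    simp only [Function.comp]
    split_ifs with h h' h'
    · rw [hc_mono, if_pos (by rw [degA_toF m h, h'])]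
    · rw [hc_mono, if_neg (by rw [degA_toF m h]; exact h')]
    · simp
    · simp
  · congr 1
    apply List.map_congr_left
    intro m hm
    rw [if_pos (by rw [goS_length f _ m hm, hf])]

/-! ### Hit elements and lower monomials -/

theorem zmod2 (c : ZMod 2) : c = 0 ∨ c = 1 := by
  revert c; decide

/-- Polynomials all of whose monomials satisfy `Q`. -/
def SuppIn (Q : (Fin 5 →₀ ℕ) → Prop) : Submodule (ZMod 2) (P 5) where
  carrier := {p | ∀ b, coeff b p ≠ 0 → Q b}
  zero_mem' := by intro b hb; simp at hb
  add_mem' := by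
    intro p q hp hq b hb
    by_cases h : coeff b p = 0
    · exact hq b (by intro h'; apply hb; rw [coeff_add, h, h', add_zero])
    · exact hp b h
  smul_mem' := by
    intro c p hp b hb
    exact hp b (by intro h; apply hb; simp [h])

theorem mono_mem_SuppIn {Q : (Fin 5 →₀ ℕ) → Prop} {b : Fin 5 →₀ ℕ} (h : Q b) :
    mono b ∈ SuppIn Q := by
  intro c hc
  rw [mono, coeff_monomial] at hc
  split_ifs at hc with h'
  · exact h' ▸ h
  · exact absurd rfl hc

theorem eq_sum_mono (p : P 5) : p = ∑ b ∈ p.support, mono b := by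
  conv_lhs => rw [p.as_sum]
  apply Finset.sum_congr rfl
  intro b hb
  rcases zmod2 (coeff b p) with h | h
  · exact absurd h (mem_support_iff.1 hb)
  · rw [h]; rfl

theorem SuppIn_induct {Q : (Fin 5 →₀ ℕ) → Prop} {M : P 5 → Prop} (h0 : M 0)
    (ha : ∀ p q, M p → M q → M (p + q)) (hm : ∀ b, Q b → M (mono b)) (p : P 5)
    (hp : p ∈ SuppIn Q) : M p := by
  rw [eq_sum_mono p]
  apply Finset.sum_induction _ M ha h0
  intro b hb
  exact hm b (hp b (mem_support_iff.1 hb))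

theorem mono_mul {n : ℕ} (a b : Fin n →₀ ℕ) : mono a * mono b = mono (a + b) := by
  simp [mono, monomial_mul]

theorem mono_sq {n : ℕ} (a : Fin n →₀ ℕ) : mono a ^ 2 = mono (a + a) := by
  rw [pow_two, mono_mul]

theorem SuppIn_mul {Q R S : (Fin 5 →₀ ℕ) → Prop} (h : ∀ b c, Q b → R c → S (b + c)) {p q : P 5}
    (hp : p ∈ SuppIn Q) (hq : q ∈ SuppIn R) : p * q ∈ SuppIn S := by
  refine SuppIn_induct (M := fun p => p * q ∈ SuppIn S) ?_ ?_ ?_ p hp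
  · simp
  · intro p q hp hq; rw [add_mul]; exact add_mem hp hq
  · intro b hb
    refine SuppIn_induct (M := fun q => mono b * q ∈ SuppIn S) ?_ ?_ ?_ q hq
    · simp
    · intro p q hp hq; rw [mul_add]; exact add_mem hp hq
    · intro c hc
      rw [mono_mul]; exact mono_mem_SuppIn (h b c hb hc)

theorem SuppIn_mono {Q R : (Fin 5 →₀ ℕ) → Prop} (h : ∀ b, Q b → R b) {p : P 5}
    (hp : p ∈ SuppIn Q) : p ∈ SuppIn R := fun b hb => h b (hp b hb)

theorem hc_SuppIn {Q : (Fin 5 →₀ ℕ) → Prop} {p : P 5} (d : ℕ) (hp : p ∈ SuppIn Q) :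
    homogeneousComponent d p ∈ SuppIn (fun b => degA b = d ∧ Q b) := by
  intro b hb
  rw [coeff_homogeneousComponent, degree_eq] at hb
  split_ifs at hb with h
  · exact ⟨h, hp b hb⟩
  · exact absurd rfl hb

def Hs (d : ℕ) : Submodule (ZMod 2) (P 5) :=
  Submodule.span (ZMod 2)
    {u | ∃ b : Fin 5 →₀ ℕ, degA b < d ∧ u = homogeneousComponent d (SqT 5 (mono b))}

def Lw (d : ℕ) (w : ℕ → ℕ) : Submodule (ZMod 2) (P 5) :=
  SuppIn (fun b => degA b = d ∧ lexLtN (wVec b) w)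

def NN (d : ℕ) (w : ℕ → ℕ) : Submodule (ZMod 2) (P 5) := Hs d ⊔ Lw d w

def Good (a : Fin 5 →₀ ℕ) : Prop := mono a ∈ NN (degA a) (wVec a)

theorem isHit_mem_Hs {d : ℕ} {u : P 5} (h : IsHit 5 d u) : u ∈ Hs d := by
  obtain ⟨f, hf, rfl⟩ := h
  apply Submodule.sum_mem
  intro i hi
  rw [Finset.mem_Icc] at hi
  rw [eq_sum_mono (f i), map_sum, map_sum]
  apply Submodule.sum_mem
  intro b hb
  apply Submodule.subset_span
  refine ⟨b, ?_, rfl⟩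
  have h1 := (mem_homogeneousSubmodule _ _).1 (hf i)
  have h2 : b.degree = d - i := by
    by_contra hne
    exact mem_support_iff.1 hb (h1.coeff_eq_zero hne)
  rw [degree_eq] at h2
  omega

theorem mem_Hs_isHit {d : ℕ} {u : P 5} (h : u ∈ Hs d) : IsHit 5 d u := by
  induction h using Submodule.span_induction with
  | mem u hu =>
    obtain ⟨b, hb, rfl⟩ := hu
    refine ⟨fun i => if i = d - degA b then mono b else 0, ?_, ?_⟩
    · intro i
      by_cases hi : i = d - degA b
      · simp only [if_pos hi]
        rw [mem_homogeneousSubmodule, mono]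
        apply isHomogeneous_monomial
        rw [degree_eq]; omega
      · simp only [if_neg hi]; exact zero_mem _
    · rw [Finset.sum_eq_single (d - degA b)]
      · simp
      · intro i _ hi; simp [hi]
      · intro hi; exfalso; apply hi; rw [Finset.mem_Icc]; omega
  | zero => exact ⟨fun _ => 0, fun i => zero_mem _, by simp⟩
  | add u v _ _ hu hv =>
    obtain ⟨f, hf, rfl⟩ := hu
    obtain ⟨g, hg, rfl⟩ := hv
    exact ⟨fun i => f i + g i, fun i => add_mem (hf i) (hg i), by
      simp [Finset.sum_add_distrib]⟩
  | smul c u _ hu =>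
    obtain ⟨f, hf, rfl⟩ := hu
    exact ⟨fun i => c • f i, fun i => Submodule.smul_mem _ c (hf i), by
      simp [Finset.smul_sum]⟩

theorem Good.not_admissible {a : Fin 5 →₀ ℕ} (h : Good a) : ¬ Admissible a := by
  obtain ⟨u, hu, l, hl, e⟩ := Submodule.mem_sup.1 h
  rw [Admissible, not_not]
  refine ⟨l.support, ?_, ?_⟩
  · intro b hb
    obtain ⟨h1, h2⟩ := hl b (mem_support_iff.1 hb)
    exact ⟨h1, Or.inl h2⟩
  · rw [← eq_sum_mono l, ← e, add_sub_cancel_right]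
    exact mem_Hs_isHit hu

theorem degA_add {n : ℕ} (a b : Fin n →₀ ℕ) : degA (a + b) = degA a + degA b := by
  simp [degA, Finset.sum_add_distrib]

theorem wVec_zero {n : ℕ} (a : Fin n →₀ ℕ) : wVec a 0 = ∑ j, a j % 2 := by
  rw [wVec]
  apply Finset.sum_congr rfl
  intro j _
  rcases Nat.mod_two_eq_zero_or_one (a j) with h | h <;> simp [Nat.testBit_zero, h]

theorem wVec_add_double {n : ℕ} (a b : Fin n →₀ ℕ) : wVec (a + (b + b)) 0 = wVec a 0 := by
  rw [wVec_zero, wVec_zero]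
  apply Finset.sum_congr rfl
  intro j _
  simp only [Finsupp.coe_add, Pi.add_apply]; omega

theorem wVec_succ {n : ℕ} (e b : Fin n →₀ ℕ) (he : ∀ i, e i ≤ 1) (t : ℕ) :
    wVec (e + (b + b)) (t + 1) = wVec b t := by
  rw [wVec, wVec]
  apply Finset.sum_congr rfl
  intro j _
  have := he j
  have h : (e + (b + b)) j / 2 = b j := by
    simp only [Finsupp.coe_add, Pi.add_apply]; omega
  rw [Nat.testBit_succ, h]

theorem wVec_zero_small {n : ℕ} (e : Fin n →₀ ℕ) (he : ∀ i, e i ≤ 1) : wVec e 0 = degA e := by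
  rw [wVec_zero, degA]
  apply Finset.sum_congr rfl
  intro j _
  have := he j
  omega

theorem Sq_small (e : Fin 5 →₀ ℕ) (he : ∀ i, e i ≤ 1) :
    SqT 5 (mono e) - mono e ∈ SuppIn (fun b => wVec b 0 < degA e) := by
  have h1 : SqT 5 (mono e) = ∏ i ∈ e.support, (X i + X i ^ 2 : P 5) := by
    rw [SqT_mono, ← Finset.prod_subset (Finset.subset_univ e.support)]
    · apply Finset.prod_congr rfl
      intro i hi
      have := he i
      rw [show e i = 1 by have := Finsupp.mem_support_iff.1 hi; omega, pow_one]
    · intro i _ hi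
      rw [Finsupp.notMem_support_iff.1 hi, pow_zero]
  have h2 : ∀ t ∈ e.support.powerset, (∏ i ∈ t, (X i : P 5)) * ∏ i ∈ e.support \ t, (X i : P 5) ^ 2
      = mono (Finsupp.equivFunOnFinite.symm
          (fun i => if i ∈ t then 1 else if i ∈ e.support then 2 else 0)) := by
    intro t ht
    rw [Finset.mem_powerset] at ht
    rw [mono_eq_prod, ← Finset.prod_subset (Finset.subset_univ e.support),
      ← Finset.prod_sdiff ht, mul_comm]
    · congr 1
      · apply Finset.prod_congr rfl
        intro i hi
        rw [Finset.mem_sdiff] at hi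
        simp only [Finsupp.equivFunOnFinite_symm_apply_apply, if_neg hi.2, if_pos hi.1]
      · apply Finset.prod_congr rfl
        intro i hi
        simp only [Finsupp.equivFunOnFinite_symm_apply_apply, if_pos hi, pow_one]
    · intro i _ hi
      have : i ∉ t := fun h => hi (ht h)
      simp only [Finsupp.equivFunOnFinite_symm_apply_apply, if_neg hi, if_neg this, pow_zero]
  rw [h1, Finset.prod_add, Finset.sum_congr rfl h2, Finset.powerset, ← Finset.powerset,
    ← Finset.add_sum_erase _ _ (Finset.mem_powerset_self e.support)]
  have h3 : Finsupp.equivFunOnFinite.symm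
          (fun i => if i ∈ e.support then 1 else if i ∈ e.support then 2 else 0) = e := by
    ext i
    have := he i
    by_cases h : i ∈ e.support
    · simp only [Finsupp.equivFunOnFinite_symm_apply_apply, if_pos h]
      have := Finsupp.mem_support_iff.1 h; omega
    · simp only [Finsupp.equivFunOnFinite_symm_apply_apply, if_neg h]
      rw [Finsupp.notMem_support_iff.1 h]
  rw [h3, add_sub_cancel_left]
  apply Submodule.sum_mem
  intro t ht
  rw [Finset.mem_erase, Finset.mem_powerset] at ht
  apply mono_mem_SuppIn
  obtain ⟨i, hi, hit⟩ := Finset.exists_of_ssubset (ht.2.ssubset_of_ne ht.1)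
  rw [wVec_zero, degA]
  apply Finset.sum_lt_sum
  · intro j _
    simp only [Finsupp.equivFunOnFinite_symm_apply_apply]
    split_ifs with h h'
    · have := Finsupp.mem_support_iff.1 (ht.2 h); omega
    · omega
    · omega
  · refine ⟨i, Finset.mem_univ _, ?_⟩
    simp only [Finsupp.equivFunOnFinite_symm_apply_apply, if_neg hit, if_pos hi]
    have := Finsupp.mem_support_iff.1 hi; omega

theorem hc_T (e : Fin 5 →₀ ℕ) (d : ℕ) (g : P 5) :
    homogeneousComponent (degA e + 2 * d) (mono e * g ^ 2) =
      mono e * homogeneousComponent d g ^ 2 := by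
  refine SuppIn_induct (Q := fun _ => True) (M := fun g =>
    homogeneousComponent (degA e + 2 * d) (mono e * g ^ 2) =
      mono e * homogeneousComponent d g ^ 2) ?_ ?_ ?_ g (fun _ _ => trivial)
  · simp
  · intro p q hp hq
    simp only [map_add, CharTwo.add_sq, mul_add, hp, hq]
  · intro b _
    rw [mono_sq, mono_mul, hc_mono, hc_mono, degA_add, degA_add]
    by_cases h : degA b = d
    · rw [if_pos h, if_pos (by omega), mono_sq, mono_mul]
    · rw [if_neg h, if_neg (by omega)]; simp

theorem sq_SuppIn (g : P 5) : g ^ 2 ∈ SuppIn (fun b => ∃ c, b = c + c) := by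
  refine SuppIn_induct (Q := fun _ => True) (M := fun g => g ^ 2 ∈ SuppIn (fun b => ∃ c, b = c + c))
    ?_ ?_ ?_ g (fun _ _ => trivial)
  · simp
  · intro p q hp hq
    rw [CharTwo.add_sq]; exact add_mem hp hq
  · intro b _
    rw [mono_sq]; exact mono_mem_SuppIn ⟨b, rfl⟩

theorem lift_gen (e : Fin 5 →₀ ℕ) (he : ∀ i, e i ≤ 1) (d : ℕ) (w : ℕ → ℕ) (hw : w 0 = degA e)
    (b : Fin 5 →₀ ℕ) (hb : degA b < d) :
    mono e * homogeneousComponent d (SqT 5 (mono b)) ^ 2 ∈ NN (degA e + 2 * d) w := by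
  set D := degA e + 2 * d with hD
  have h1 : homogeneousComponent D (SqT 5 (mono (e + (b + b)))) =
      mono e * homogeneousComponent d (SqT 5 (mono b)) ^ 2 +
      homogeneousComponent D ((SqT 5 (mono e) - mono e) * SqT 5 (mono b) ^ 2) := by
    rw [← hc_T, ← map_add, ← mono_mul, ← mono_sq, map_mul, map_pow]
    congr 1; ring
  rw [eq_sub_of_add_eq h1.symm]
  apply sub_mem
  · apply Submodule.mem_sup_left
    apply Submodule.subset_span
    exact ⟨_, by rw [degA_add, degA_add]; omega, rfl⟩
  · apply Submodule.mem_sup_right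
    have := hc_SuppIn D (SuppIn_mul (S := fun b => wVec b 0 < degA e) (by
      rintro b _ hb ⟨c, rfl⟩
      rw [wVec_add_double]; exact hb) (Sq_small e he) (sq_SuppIn (SqT 5 (mono b))))
    refine SuppIn_mono ?_ this
    rintro b ⟨h1, h2⟩
    exact ⟨h1, 0, by intro j hj; omega, by rw [hw]; exact h2⟩

theorem lift_NN (e : Fin 5 →₀ ℕ) (he : ∀ i, e i ≤ 1) (d : ℕ) (w w' : ℕ → ℕ) (hw : w 0 = degA e)
    (hw' : ∀ t, w (t + 1) = w' t) (u : P 5) (hu : u ∈ NN d w') :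
    mono e * u ^ 2 ∈ NN (degA e + 2 * d) w := by
  obtain ⟨h, hh, l, hl, rfl⟩ := Submodule.mem_sup.1 hu
  rw [CharTwo.add_sq, mul_add]
  apply add_mem
  · induction hh using Submodule.span_induction with
    | mem x hx =>
      obtain ⟨b, hb, rfl⟩ := hx
      exact lift_gen e he d w hw b hb
    | zero => simp
    | add x y _ _ hx hy =>
      rw [CharTwo.add_sq, mul_add]
      exact add_mem (hx (Submodule.add_mem _ (by assumption) (by exact Submodule.mem_sup_right hl) |> fun _ => by
        exact Submodule.add_mem _ (Submodule.mem_sup_left (by assumption)) (Submodule.mem_sup_right hl)))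
        (hy (Submodule.add_mem _ (Submodule.mem_sup_left (by assumption)) (Submodule.mem_sup_right hl)))
    | smul c x _ hx =>
      rcases zmod2 c with rfl | rfl
      · simp
      · rw [one_smul]
        exact hx (Submodule.add_mem _ (Submodule.mem_sup_left (by assumption))
          (Submodule.mem_sup_right hl))
  · apply Submodule.mem_sup_right
    refine SuppIn_induct (M := fun l => mono e * l ^ 2 ∈ Lw (degA e + 2 * d) w) ?_ ?_ ?_ l hl
    · simp
    · intro p q hp hq
      rw [CharTwo.add_sq, mul_add]; exact add_mem hp hq
    · rintro b ⟨hb, i, h1, h2⟩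
      rw [mono_sq, mono_mul]
      apply mono_mem_SuppIn
      refine ⟨by rw [degA_add, degA_add]; omega, i + 1, ?_, ?_⟩
      · intro j hj
        cases j with
        | zero => rw [wVec_add_double, wVec_zero_small e he, hw]
        | succ j => rw [wVec_succ e b he, hw', h1 j (by omega)]
      · rw [wVec_succ e b he, hw']; exact h2

def half (a : Fin 5 →₀ ℕ) : Fin 5 →₀ ℕ := Finsupp.equivFunOnFinite.symm (fun i => a i / 2)
def par (a : Fin 5 →₀ ℕ) : Fin 5 →₀ ℕ := Finsupp.equivFunOnFinite.symm (fun i => a i % 2)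

theorem par_le (a : Fin 5 →₀ ℕ) (i : Fin 5) : par a i ≤ 1 := by
  have : par a i = a i % 2 := rfl
  omega

theorem par_half (a : Fin 5 →₀ ℕ) : par a + (half a + half a) = a := by
  ext i
  have h1 : par a i = a i % 2 := rfl
  have h2 : half a i = a i / 2 := rfl
  simp only [Finsupp.coe_add, Pi.add_apply]; omega

theorem degA_par (a : Fin 5 →₀ ℕ) : degA (par a) = wVec a 0 := by
  rw [wVec_zero, degA]; rfl

theorem degA_half (a : Fin 5 →₀ ℕ) : degA a = wVec a 0 + 2 * degA (half a) := by
  conv_lhs => rw [← par_half a]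
  rw [degA_add, degA_add, degA_par]; omega

theorem wVec_half (a : Fin 5 →₀ ℕ) (t : ℕ) : wVec a (t + 1) = wVec (half a) t := by
  conv_lhs => rw [← par_half a]
  rw [wVec_succ _ _ (par_le a)]

theorem wVec_le (a : Fin 5 →₀ ℕ) (t : ℕ) : wVec a t ≤ 5 := by
  rw [wVec]
  calc _ ≤ ∑ j : Fin 5, 1 := Finset.sum_le_sum (fun j _ => by split_ifs <;> omega)
    _ = 5 := by simp

theorem Good.of_half {a : Fin 5 →₀ ℕ} (h : Good (half a)) : Good a := by
  have := lift_NN (par a) (par_le a) (degA (half a)) (wVec a) (wVec (half a)) (degA_par a).symm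
    (wVec_half a) _ h
  rw [mono_sq, mono_mul, par_half, degA_par, ← degA_half] at this
  exact this

theorem SqT_mono_range (z : Fin 5 →₀ ℕ) :
    SqT 5 (mono z) - mono z ^ 2 ∈ SuppIn (fun b => degA b < 2 * degA z) ∧
    SqT 5 (mono z) ∈ SuppIn (fun b => degA z ≤ degA b) := by
  have hadd : ∀ y z : Fin 5 →₀ ℕ,
    (SqT 5 (mono y) - mono y ^ 2 ∈ SuppIn (fun b => degA b < 2 * degA y) ∧
    SqT 5 (mono y) ∈ SuppIn (fun b => degA y ≤ degA b)) →
    (SqT 5 (mono z) - mono z ^ 2 ∈ SuppIn (fun b => degA b < 2 * degA z) ∧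
    SqT 5 (mono z) ∈ SuppIn (fun b => degA z ≤ degA b)) →
    (SqT 5 (mono (y + z)) - mono (y + z) ^ 2 ∈ SuppIn (fun b => degA b < 2 * degA (y + z)) ∧
    SqT 5 (mono (y + z)) ∈ SuppIn (fun b => degA (y + z) ≤ degA b)) := by
    intro y z ⟨h1, h2⟩ ⟨h3, h4⟩
    have hs : ∀ z : Fin 5 →₀ ℕ, mono z ^ 2 ∈ SuppIn (fun b => degA b = 2 * degA z) := by
      intro z
      rw [mono_sq]
      exact mono_mem_SuppIn (by rw [degA_add]; omega)
    constructor
    · rw [← mono_mul, map_mul,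
        show SqT 5 (mono y) * SqT 5 (mono z) - (mono y * mono z) ^ 2 =
          (SqT 5 (mono y) - mono y ^ 2) * (SqT 5 (mono z) - mono z ^ 2) +
          (SqT 5 (mono y) - mono y ^ 2) * mono z ^ 2 +
          mono y ^ 2 * (SqT 5 (mono z) - mono z ^ 2) by ring]
      refine add_mem (add_mem ?_ ?_) ?_
      · exact SuppIn_mul (by intro b c hb hc; rw [degA_add, degA_add]; omega) h1 h3
      · exact SuppIn_mul (by intro b c hb hc; rw [degA_add, degA_add]; omega) h1 (hs z)
      · exact SuppIn_mul (by intro b c hb hc; rw [degA_add, degA_add]; omega) (hs y) h3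
    · rw [← mono_mul, map_mul]
      exact SuppIn_mul (by intro b c hb hc; rw [degA_add, degA_add]; omega) h2 h4
  have hzero : SqT 5 (mono 0) - mono 0 ^ 2 ∈ SuppIn (fun b => degA b < 2 * degA (0 : Fin 5 →₀ ℕ)) ∧
    SqT 5 (mono 0) ∈ SuppIn (fun b => degA (0 : Fin 5 →₀ ℕ) ≤ degA b) := by
    have h1 : (mono 0 : P 5) = 1 := by simp [mono]
    constructor
    · rw [h1]; simp
    · exact fun b _ => by simp [degA]
  induction z using Finsupp.induction_linear with
  | zero => exact hzero
  | add y z hy hz => exact hadd y z hy hz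
  | single i k =>
    induction k with
    | zero => rw [Finsupp.single_zero]; exact hzero
    | succ k ih =>
      rw [Finsupp.single_add]
      apply hadd _ _ ih
      have h1 : (mono (Finsupp.single i 1) : P 5) = X i := rfl
      have h2 : degA (Finsupp.single i 1) = 1 := by
        rw [← degree_eq]; simp
      have h3 : SqT 5 (mono (Finsupp.single i 1)) =
          mono (Finsupp.single i 1) + mono (Finsupp.single i 1) ^ 2 := by
        rw [h1]; simp [SqT]
      rw [h3, add_sub_cancel_right]
      constructor
      · exact mono_mem_SuppIn (by omega)
      · refine add_mem (mono_mem_SuppIn (by omega)) ?_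
        rw [mono_sq]; exact mono_mem_SuppIn (by rw [degA_add]; omega)

theorem hc_zero_of {Q : (Fin 5 →₀ ℕ) → Prop} {p : P 5} {d : ℕ} (hp : p ∈ SuppIn Q)
    (h : ∀ b, Q b → degA b ≠ d) : homogeneousComponent d p = 0 := by
  apply homogeneousComponent_eq_zero'
  intro b hb
  rw [degree_eq]
  exact h b (hp b (mem_support_iff.1 hb))

theorem good_even {a : Fin 5 →₀ ℕ} (h : wVec a 0 = 0) (h0 : degA a ≠ 0) : Good a := by
  apply Submodule.mem_sup_left
  apply Submodule.subset_span
  have hd := degA_half a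
  refine ⟨half a, by omega, ?_⟩
  have hp : par a = 0 := by
    ext i
    have : ∑ j, a j % 2 = 0 := by rw [← wVec_zero]; exact h
    rw [Finset.sum_eq_zero_iff] at this
    exact this i (Finset.mem_univ _)
  have h2 : mono a = mono (half a) ^ 2 := by
    rw [mono_sq]
    conv_lhs => rw [← par_half a, hp, zero_add]
  have h3 : SqT 5 (mono (half a)) = mono a + (SqT 5 (mono (half a)) - mono (half a) ^ 2) := by
    rw [h2]; ring
  rw [h3, map_add, hc_mono, if_pos rfl, hc_zero_of (SqT_mono_range (half a)).1, add_zero]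
  intro b hb; omega

theorem good_chi {a : Fin 5 →₀ ℕ} (h : wVec a 0 = 1) (h0 : degA a = 67) : Good a := by
  apply Submodule.mem_sup_left
  have hd := degA_half a
  set v := half a with hv
  have hdv : degA v = 33 := by omega
  obtain ⟨p, hp⟩ : ∃ p, par a = Finsupp.single p 1 := by
    have h1 : degA (par a) = 1 := by rw [degA_par, h]
    have h2 : ∃ p, par a p ≠ 0 := by
      by_contra! hc
      rw [degA, Finset.sum_eq_zero (fun i _ => hc i)] at h1
      omega
    obtain ⟨p, hp⟩ := h2
    refine ⟨p, ?_⟩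
    ext j
    have h3 := par_le a p
    by_cases hj : p = j
    · subst hj; rw [Finsupp.single_eq_same]; omega
    · rw [Finsupp.single_eq_of_ne (Ne.symm hj)]
      have h4 : ∑ i ∈ {p, j}, par a i ≤ degA (par a) :=
        Finset.sum_le_sum_of_subset (Finset.subset_univ _)
      rw [Finset.sum_pair hj] at h4
      omega
  have ha : mono a = X p * mono v ^ 2 := by
    conv_lhs => rw [← par_half a, ← mono_mul, hp, ← mono_sq]
    rfl
  have hX : ∀ k, (X p : P 5) ^ k = mono (Finsupp.single p k) := by
    intro k; rw [X_pow_eq_monomial]; rfl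
  have hdeg : ∀ k, degA (Finsupp.single p k) = k := by
    intro k; rw [← degree_eq]; simp
  have hc : SqT 5 (∑ k ∈ Finset.range 6, (X p : P 5) ^ (2 ^ k)) = X p + X p ^ 64 := by
    have hk : ∀ k, SqT 5 ((X p : P 5) ^ (2 ^ k)) = X p ^ (2 ^ k) + X p ^ (2 ^ (k + 1)) := by
      intro k
      rw [map_pow, show SqT 5 (X p) = X p + X p ^ 2 by simp [SqT], add_pow_char_pow, ← pow_mul,
        pow_succ' 2 k]
    rw [map_sum, Finset.sum_congr rfl (fun k _ => hk k)]
    simp only [Finset.sum_range_succ, Finset.sum_range_zero]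
    norm_num
    have h2 : (2 : P 5) = 0 := CharTwo.two_eq_zero
    linear_combination (X p ^ 2 + X p ^ 4 + X p ^ 8 + X p ^ 16 + X p ^ 32) * h2
  have key : mono a = homogeneousComponent 67
      (SqT 5 ((∑ k ∈ Finset.range 6, (X p : P 5) ^ (2 ^ k)) * mono v)) := by
    rw [map_mul, hc, show (X p + X p ^ 64) * SqT 5 (mono v) = mono a +
      X p * (SqT 5 (mono v) - mono v ^ 2) + X p ^ 64 * SqT 5 (mono v) by rw [ha]; ring]
    rw [map_add, map_add, hc_mono, if_pos h0,
      hc_zero_of (Q := fun b => degA b < 67) (p := X p * _),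
      hc_zero_of (Q := fun b => 67 < degA b) (p := X p ^ 64 * _), add_zero, add_zero]
    · rw [hX]
      refine SuppIn_mul ?_ (mono_mem_SuppIn (Q := fun b => degA b = 64) (hdeg 64))
        (SqT_mono_range v).2
      intro b c hb hc
      rw [degA_add]; omega
    · intro b hb; omega
    · have := hX 1
      rw [pow_one] at this
      rw [this]
      refine SuppIn_mul ?_ (mono_mem_SuppIn (Q := fun b => degA b = 1) (hdeg 1))
        (SqT_mono_range v).1
      intro b c hb hc
      rw [degA_add]; omega
    · intro b hb; omega
  rw [key, Finset.sum_mul, map_sum, map_sum, h0]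
  apply Submodule.sum_mem
  intro k hk
  rw [Finset.mem_range] at hk
  apply Submodule.subset_span
  refine ⟨Finsupp.single p (2 ^ k) + v, ?_, by rw [hX, mono_mul]⟩
  rw [degA_add, hdeg, hdv]
  have : 2 ^ k ≤ 2 ^ 5 := Nat.pow_le_pow_right (by omega) (by omega)
  omega

/-! ### The certificate checker -/

def oddc : List ℕ → ℕ
  | [] => 0
  | a :: as => a % 2 + oddc as

def halfL : List ℕ → List ℕ
  | [] => []
  | a :: as => (a / 2) :: halfL as

/-- The weight of `m` is smaller than `ω`. -/
def isLow : List ℕ → List ℕ → Bool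
  | [], _ => false
  | w :: ws, m => bif Nat.ble (oddc m + 1) w then true else
      bif Nat.beq (oddc m) w then isLow ws (halfL m) else false

def wEq : List ℕ → List ℕ → Bool
  | [], _ => true
  | w :: ws, m => bif Nat.beq (oddc m) w then wEq ws (halfL m) else false

def insL (a : ℕ) : List ℕ → List ℕ
  | [] => [a]
  | b :: l => bif Nat.ble a b then a :: b :: l else b :: insL a l

def isort : List ℕ → List ℕ
  | [] => []
  | a :: l => insL a (isort l)

def eqL : List ℕ → List ℕ → Bool
  | [], [] => true
  | a :: as, b :: bs => bif Nat.beq a b then eqL as bs else false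
  | _, _ => false

def kmem (x : List ℕ) : List (List ℕ) → Bool
  | [] => false
  | y :: l => bif eqL x y then true else kmem x l

def toggle (x : List ℕ) : List (List ℕ) → List (List ℕ)
  | [] => [x]
  | y :: l => bif eqL x y then l else y :: toggle x l

def addTerms (w : List ℕ) (known : List (List ℕ)) :
    List (List ℕ) → List (List ℕ) → List (List ℕ)
  | [], acc => acc
  | m :: ms, acc => addTerms w known ms
      (bif isLow w m then acc else bif kmem (isort m) known then acc else toggle m acc)

def collect (w : List ℕ) (known : List (List ℕ)) (d : ℕ) :
    List (List ℕ) → List (List ℕ) → List (List ℕ)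
  | [], acc => acc
  | f :: fs, acc => collect w known d fs
      (bif Nat.beq f.length 5 then
        bif Nat.ble (f.sum + 1) d then addTerms w known (goS f (d - f.sum)) acc else acc
       else acc)

def upd (known : List (List ℕ)) : List (List ℕ) → List (List ℕ)
  | [m] => bif Nat.beq m.length 5 then isort m :: known else known
  | _ => known

def run (w : List ℕ) (d : ℕ) : List (List (List ℕ)) → List (List ℕ) → List (List ℕ)
  | [], known => known
  | fs :: c, known => run w d c (upd known (collect w known d fs []))

def gen : ℕ → ℕ → ℕ → List (List ℕ)
  | 0, _, s => bif Nat.beq s 0 then [[]] else []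
  | 1, lo, s => bif Nat.ble lo s then [[s]] else []
  | k + 2, lo, s => (List.range (s + 1)).flatMap (fun a =>
      bif Nat.ble lo a then bif Nat.ble ((k + 2) * a) s then
        (gen (k + 1) a (s - a)).map (fun m => a :: m) else [] else [])

def cov (w : List ℕ) (known : List (List ℕ)) : List (List ℕ) → Bool
  | [] => true
  | m :: ms => bif wEq w m then bif kmem m known then cov w known ms else false
      else cov w known ms

def check (w : List ℕ) (d : ℕ) (c : List (List (List ℕ))) : Bool :=
  cov w (run w d c []) (gen 5 0 d)

/-! ### Soundness of the checker -/

theorem halfL_length (m : List ℕ) : (halfL m).length = m.length := by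
  induction m with
  | nil => rfl
  | cons a m ih => simp [halfL, ih]

theorem wVec_toF_zero (m : List ℕ) (h : m.length = 5) : wVec (toF m) 0 = oddc m := by
  match m, h with
  | [a, b, c, d, e], _ =>
    rw [wVec_zero]; simp [toF_apply, Fin.sum_univ_five, oddc]; ring

theorem half_toF (m : List ℕ) (h : m.length = 5) : half (toF m) = toF (halfL m) := by
  match m, h with
  | [a, b, c, d, e], _ =>
    ext i
    have : half (toF [a, b, c, d, e]) i = toF [a, b, c, d, e] i / 2 := rfl
    rw [this]
    fin_cases i <;> rfl

theorem isLow_spec (w : List ℕ) : ∀ m : List ℕ, m.length = 5 → isLow w m = true →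
    lexLtN (wVec (toF m)) (fun t => w.getD t 0) := by
  induction w with
  | nil => intro m _ h; simp [isLow] at h
  | cons x w ih =>
    intro m hm h
    rw [isLow] at h
    cases h1 : Nat.ble (oddc m + 1) x
    · cases h2 : Nat.beq (oddc m) x
      · simp [h1, h2] at h
      · simp only [h1, h2, cond_true, cond_false] at h
        obtain ⟨i, h3, h4⟩ := ih (halfL m) (by rw [halfL_length, hm]) h
        refine ⟨i + 1, ?_, ?_⟩
        · intro j hj
          cases j with
          | zero => rw [wVec_toF_zero m hm, Nat.eq_of_beq_eq_true h2]; rfl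
          | succ j => rw [wVec_half, half_toF m hm, h3 j (by omega)]; rfl
        · rw [wVec_half, half_toF m hm]; exact h4
    · refine ⟨0, by intro j hj; omega, ?_⟩
      rw [wVec_toF_zero m hm]
      exact Nat.le_of_ble_eq_true h1

theorem wEq_spec (w : List ℕ) : ∀ m : List ℕ, m.length = 5 →
    (∀ t, wVec (toF m) t = w.getD t 0) → wEq w m = true := by
  induction w with
  | nil => intro m _ _; rfl
  | cons x w ih =>
    intro m hm h
    have h0 := h 0
    rw [wVec_toF_zero m hm] at h0
    have h1 : Nat.beq (oddc m) x = true := by rw [h0]; exact Nat.beq_refl _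
    rw [wEq, h1, cond_true]
    apply ih _ (by rw [halfL_length, hm])
    intro t
    rw [← half_toF m hm, ← wVec_half, h]; rfl

theorem insL_perm (a : ℕ) (l : List ℕ) : (insL a l).Perm (a :: l) := by
  induction l with
  | nil => exact List.Perm.refl _
  | cons b l ih =>
    rw [insL]
    cases Nat.ble a b
    · exact (ih.cons b).trans (List.Perm.swap _ _ _)
    · exact List.Perm.refl _

theorem isort_perm (l : List ℕ) : (isort l).Perm l := by
  induction l with
  | nil => exact List.Perm.refl _
  | cons b l ih => exact (insL_perm b _).trans (ih.cons b)

theorem eqL_spec (l : List ℕ) : ∀ m, eqL l m = true → l = m := by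
  induction l with
  | nil => intro m h; cases m with
    | nil => rfl
    | cons b m => simp [eqL] at h
  | cons a l ih => intro m h; cases m with
    | nil => simp [eqL] at h
    | cons b m =>
      rw [eqL] at h
      cases h1 : Nat.beq a b
      · simp [h1] at h
      · rw [h1, cond_true] at h
        rw [Nat.eq_of_beq_eq_true h1, ih m h]

theorem kmem_spec (x : List ℕ) (l : List (List ℕ)) : kmem x l = true → x ∈ l := by
  induction l with
  | nil => intro h; simp [kmem] at h
  | cons y l ih =>
    intro h
    rw [kmem] at h
    cases h1 : eqL x y
    · rw [h1, cond_false] at h; exact List.mem_cons_of_mem _ (ih h)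
    · rw [eqL_spec _ _ h1]; exact List.mem_cons_self

/-- The sum of the monomials in a list. -/
def S (l : List (List ℕ)) : P 5 := (l.map (fun m => mono (toF m))).sum

theorem S_cons (m : List ℕ) (l : List (List ℕ)) : S (m :: l) = mono (toF m) + S l := by
  simp [S]

theorem S_toggle (x : List ℕ) (l : List (List ℕ)) : S (toggle x l) = mono (toF x) + S l := by
  induction l with
  | nil => rw [toggle, S_cons]
  | cons y l ih =>
    rw [toggle]
    cases h1 : eqL x y
    · rw [cond_false, S_cons, S_cons, ih]; ring
    · rw [cond_true, eqL_spec _ _ h1, S_cons, ← add_assoc, CharTwo.add_self_eq_zero, zero_add]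

theorem goS_sum (as : List ℕ) : ∀ s, ∀ m ∈ goS as s, m.sum = as.sum + s := by
  induction as with
  | nil =>
    intro s m hm
    cases h : Nat.beq s 0
    · simp [goS, h] at hm
    · have := Nat.eq_of_beq_eq_true h
      subst this
      simp [goS] at hm
      simp [hm]
  | cons a as ih =>
    intro s m hm
    simp only [goS, List.mem_flatMap] at hm
    obtain ⟨j, _, hm⟩ := hm
    cases h : Nat.ble j s
    · simp [h] at hm
    · simp only [h, cond_true, List.mem_map] at hm
      obtain ⟨m', hm', rfl⟩ := hm
      have := Nat.le_of_ble_eq_true h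
      have := ih _ m' hm'
      simp only [List.sum_cons]; omega

theorem perm_toF {l l' : List ℕ} (h : l.Perm l') : ∀ pre : List ℕ, (pre ++ l).length = 5 →
    ∃ σ : Equiv.Perm (Fin 5), ∀ i, toF (pre ++ l') (σ i) = toF (pre ++ l) i := by
  induction h with
  | nil => intro pre _; exact ⟨1, fun i => rfl⟩
  | cons x h ih =>
    intro pre hp
    have := ih (pre ++ [x]) (by simpa using hp)
    simpa using this
  | swap x y l =>
    intro pre hp
    match pre, hp with
    | [], hp =>
      refine ⟨Equiv.swap 0 1, fun i => ?_⟩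
      fin_cases i <;> rfl
    | [_], hp =>
      refine ⟨Equiv.swap 1 2, fun i => ?_⟩
      fin_cases i <;> rfl
    | [_, _], hp =>
      refine ⟨Equiv.swap 2 3, fun i => ?_⟩
      fin_cases i <;> rfl
    | [_, _, _], hp =>
      refine ⟨Equiv.swap 3 4, fun i => ?_⟩
      fin_cases i <;> rfl
    | _ :: _ :: _ :: _ :: _, hp => simp at hp; omega
  | trans h1 h2 ih1 ih2 =>
    intro pre hp
    obtain ⟨σ, hσ⟩ := ih1 pre hp
    obtain ⟨τ, hτ⟩ := ih2 pre (by
      have := h1.length_eq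
      simp only [List.length_append] at hp ⊢; omega)
    exact ⟨σ.trans τ, fun i => by rw [Equiv.trans_apply, hτ, hσ]⟩

theorem rename_mono (σ : Equiv.Perm (Fin 5)) (b : Fin 5 →₀ ℕ) :
    rename σ (mono b) = mono (b.mapDomain σ) := by
  rw [mono, rename_monomial]; rfl

theorem rename_SqT (σ : Equiv.Perm (Fin 5)) (p : P 5) :
    rename σ (SqT 5 p) = SqT 5 (rename σ p) := by
  have : (rename σ).comp (SqT 5) = (SqT 5).comp (rename σ) := by
    apply MvPolynomial.algHom_ext
    intro i
    simp [SqT]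
  exact DFunLike.congr_fun this p

theorem mapDomain_perm (σ : Equiv.Perm (Fin 5)) (b : Fin 5 →₀ ℕ) (i : Fin 5) :
    b.mapDomain σ (σ i) = b i := Finsupp.mapDomain_apply σ.injective b i

theorem degA_perm (σ : Equiv.Perm (Fin 5)) (b : Fin 5 →₀ ℕ) : degA (b.mapDomain σ) = degA b := by
  rw [degA, degA, ← Equiv.sum_comp σ]
  simp only [mapDomain_perm]

theorem wVec_perm (σ : Equiv.Perm (Fin 5)) (b : Fin 5 →₀ ℕ) : wVec (b.mapDomain σ) = wVec b := by
  funext t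
  rw [wVec, wVec, ← Equiv.sum_comp σ]
  simp only [mapDomain_perm]

theorem rename_NN (σ : Equiv.Perm (Fin 5)) (d : ℕ) (w : ℕ → ℕ) (u : P 5) (hu : u ∈ NN d w) :
    rename σ u ∈ NN d w := by
  obtain ⟨h, hh, l, hl, rfl⟩ := Submodule.mem_sup.1 hu
  rw [map_add]
  apply Submodule.add_mem_sup
  · clear hu hl
    induction hh using Submodule.span_induction with
    | mem x hx =>
      obtain ⟨b, hb, rfl⟩ := hx
      rw [rename_homogeneousComponent, rename_SqT, rename_mono]
      apply Submodule.subset_span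
      exact ⟨_, by rw [degA_perm]; exact hb, rfl⟩
    | zero => simp
    | add x y _ _ hx hy => rw [map_add]; exact add_mem hx hy
    | smul c x _ hx => rw [map_smul]; exact Submodule.smul_mem _ _ hx
  · refine SuppIn_induct (M := fun l => rename σ l ∈ Lw d w) ?_ ?_ ?_ l hl
    · simp
    · intro p q hp hq
      rw [map_add]; exact add_mem hp hq
    · intro b hb
      rw [rename_mono]
      apply mono_mem_SuppIn
      rw [degA_perm, wVec_perm]; exact hb

theorem perm_NN {l l' : List ℕ} (h : l.Perm l') (hl : l.length = 5) {d : ℕ} {w : ℕ → ℕ}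
    (hm : mono (toF l) ∈ NN d w) : mono (toF l') ∈ NN d w := by
  obtain ⟨σ, hσ⟩ := perm_toF h [] hl
  have := rename_NN σ d w _ hm
  rw [rename_mono] at this
  convert this using 2
  ext i
  obtain ⟨j, rfl⟩ := σ.surjective i
  rw [mapDomain_perm]
  exact hσ j

/-- Every list in `known` represents a monomial in the bad subspace. -/
def KOK (d : ℕ) (w : List ℕ) (known : List (List ℕ)) : Prop :=
  ∀ l ∈ known, l.length = 5 ∧ mono (toF l) ∈ NN d (fun t => w.getD t 0)

theorem addTerms_spec {d : ℕ} {w : List ℕ} {known : List (List ℕ)} (hk : KOK d w known)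
    (ms : List (List ℕ)) : ∀ acc, (∀ m ∈ ms, m.length = 5 ∧ m.sum = d) →
    S ms + S acc - S (addTerms w known ms acc) ∈ NN d (fun t => w.getD t 0) := by
  induction ms with
  | nil => intro acc _; simp [addTerms, S]
  | cons m ms ih =>
    intro acc hm
    obtain ⟨hm5, hmd⟩ := hm m List.mem_cons_self
    have ih' := fun acc => ih acc (fun x hx => hm x (List.mem_cons_of_mem _ hx))
    have good : mono (toF m) ∈ NN d (fun t => w.getD t 0) →
        S (m :: ms) + S acc - S (addTerms w known ms acc) ∈ NN d (fun t => w.getD t 0) := by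
      intro h
      rw [S_cons, add_assoc, add_sub_assoc]
      exact add_mem h (ih' acc)
    rw [addTerms]
    cases h1 : isLow w m
    · rw [cond_false]
      cases h2 : kmem (isort m) known
      · rw [cond_false]
        have := ih' (toggle m acc)
        rw [S_toggle] at this
        rw [S_cons]
        convert this using 1
        ring
      · rw [cond_true]
        obtain ⟨h3, h4⟩ := hk _ (kmem_spec _ _ h2)
        exact good (perm_NN (isort_perm m) h3 h4)
    · rw [cond_true]
      apply good
      apply Submodule.mem_sup_right
      apply mono_mem_SuppIn
      exact ⟨by rw [degA_toF m hm5, hmd], isLow_spec w m hm5 h1⟩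

theorem collect_spec {d : ℕ} {w : List ℕ} {known : List (List ℕ)} (hk : KOK d w known)
    (fs : List (List ℕ)) : ∀ acc,
    S acc - S (collect w known d fs acc) ∈ NN d (fun t => w.getD t 0) := by
  induction fs with
  | nil => intro acc; simp [collect]
  | cons f fs ih =>
    intro acc
    rw [collect]
    cases h1 : Nat.beq f.length 5
    · rw [cond_false]; exact ih acc
    · rw [cond_true]
      cases h2 : Nat.ble (f.sum + 1) d
      · rw [cond_false]; exact ih acc
      · rw [cond_true]
        have hf := Nat.eq_of_beq_eq_true h1
        have hd := Nat.le_of_ble_eq_true h2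
        have e1 := ih (addTerms w known (goS f (d - f.sum)) acc)
        have e2 := addTerms_spec hk (goS f (d - f.sum)) acc (by
          intro m hm
          exact ⟨by rw [goS_length _ _ m hm, hf], by rw [goS_sum _ _ m hm]; omega⟩)
        have e3 : S (goS f (d - f.sum)) ∈ NN d (fun t => w.getD t 0) := by
          rw [S, ← hc_SqT_list f hf d (by omega)]
          apply Submodule.mem_sup_left
          apply Submodule.subset_span
          exact ⟨_, by rw [degA_toF f hf]; omega, rfl⟩
        have := sub_mem (add_mem e1 e2) e3
        convert this using 1
        ring

theorem upd_spec {d : ℕ} {w : List ℕ} {known : List (List ℕ)} (hk : KOK d w known)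
    (r : List (List ℕ)) (hr : S r ∈ NN d (fun t => w.getD t 0)) : KOK d w (upd known r) := by
  match r with
  | [] => exact hk
  | _ :: _ :: _ => exact hk
  | [m] =>
    rw [upd]
    cases h1 : Nat.beq m.length 5
    · exact hk
    · have hm := Nat.eq_of_beq_eq_true h1
      intro l hl
      rw [cond_true, List.mem_cons] at hl
      rcases hl with rfl | hl
      · refine ⟨by rw [(isort_perm m).length_eq, hm], perm_NN (isort_perm m).symm hm ?_⟩
        simpa [S] using hr
      · exact hk l hl

theorem run_spec {d : ℕ} {w : List ℕ} (c : List (List (List ℕ))) : ∀ known, KOK d w known →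
    KOK d w (run w d c known) := by
  induction c with
  | nil => intro known hk; exact hk
  | cons fs c ih =>
    intro known hk
    rw [run]
    apply ih
    apply upd_spec hk
    have := collect_spec hk fs []
    rw [show S [] = 0 from rfl, zero_sub] at this
    exact (Submodule.neg_mem_iff _).1 this

theorem gen_spec (l : List ℕ) : ∀ lo, l.Pairwise (· ≤ ·) → (∀ x ∈ l, lo ≤ x) →
    l ∈ gen l.length lo l.sum := by
  induction l with
  | nil => intro lo _ _; simp [gen]
  | cons a l ih =>
    intro lo hp hlo
    cases l with
    | nil => simp [gen, Nat.ble_eq_true_of_le (hlo a List.mem_cons_self)]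
    | cons b l =>
    rw [List.pairwise_cons] at hp
    have hsum : (b :: l).length * a ≤ (b :: l).sum := by
      have := List.card_nsmul_le_sum (b :: l) a hp.1
      simpa using this
    have ih' := ih a hp.2 hp.1
    rw [List.sum_cons]
    generalize (b :: l).sum = s at hsum ih' ⊢
    simp only [List.length_cons] at hsum ih' ⊢
    simp only [gen, List.mem_flatMap]
    have hle : (l.length + 2) * a ≤ a + s := by
      rw [show l.length + 2 = l.length + 1 + 1 from rfl, add_mul (l.length + 1)]; omega
    refine ⟨a, by rw [List.mem_range]; omega, ?_⟩
    rw [Nat.ble_eq_true_of_le (hlo a List.mem_cons_self), cond_true,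
      Nat.ble_eq_true_of_le hle, cond_true, Nat.add_sub_cancel_left]
    exact List.mem_map_of_mem ih'

theorem cov_spec (w : List ℕ) (known : List (List ℕ)) (ms : List (List ℕ)) :
    cov w known ms = true → ∀ m ∈ ms, wEq w m = true → m ∈ known := by
  induction ms with
  | nil => intro _ m hm; simp at hm
  | cons x ms ih =>
    intro h m hm hw
    rw [cov] at h
    rw [List.mem_cons] at hm
    cases h1 : wEq w x
    · rw [h1, cond_false] at h
      rcases hm with rfl | hm
      · rw [h1] at hw; cases hw
      · exact ih h m hm hw
    · rw [h1, cond_true] at h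
      cases h2 : kmem x known
      · rw [h2] at h; cases h
      · rw [h2, cond_true] at h
        rcases hm with rfl | hm
        · exact kmem_spec _ _ h2
        · exact ih h m hm hw

theorem good_of_check {w : List ℕ} {d : ℕ} {c : List (List (List ℕ))} (h : check w d c = true)
    {b : Fin 5 →₀ ℕ} (hd : degA b = d) (hw : ∀ t, wVec b t = w.getD t 0) : Good b := by
  have hb : b = toF [b 0, b 1, b 2, b 3, b 4] := by
    ext i; fin_cases i <;> rfl
  set l := [b 0, b 1, b 2, b 3, b 4] with hl
  have hp : (l.insertionSort (· ≤ ·)).Perm l := List.perm_insertionSort _ l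
  set s := l.insertionSort (· ≤ ·) with hs
  have hs5 : s.length = 5 := by rw [hp.length_eq]; rfl
  obtain ⟨σ, hσ⟩ := perm_toF hp [] hs5
  have e : toF l = (toF s).mapDomain σ := by
    ext i
    obtain ⟨j, rfl⟩ := σ.surjective i
    rw [mapDomain_perm]; exact hσ j
  have hsd : s.sum = d := by
    rw [← degA_toF s hs5, ← degA_perm σ, ← e, ← hb, hd]
  have hsw : ∀ t, wVec (toF s) t = w.getD t 0 := by
    rw [← wVec_perm σ, ← e, ← hb]; exact hw
  have hg := gen_spec s 0 (List.pairwise_insertionSort _ l) (fun _ _ => Nat.zero_le _)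
  rw [hs5, hsd] at hg
  have hk := cov_spec _ _ _ h s hg (wEq_spec w s hs5 hsw)
  have hK : KOK d w (run w d c []) := run_spec c [] (by intro l hl; simp at hl)
  have := perm_NN hp hs5 (hK s hk).2
  rw [← hb] at this
  rw [Good, hd, show wVec b = (fun t => w.getD t 0) from funext hw]
  exact this

def cert_1_3_2 : List (List (List ℕ)) := [[[0, 0, 1, 6, 7]],
  [[0, 0, 3, 5, 6]],
  [[0, 1, 2, 4, 7]],
  [[0, 1, 3, 4, 6]],
  [[1, 2, 3, 4, 4]],
  [[0, 2, 2, 3, 6]],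
  [[2, 2, 2, 3, 4]],
  [[0, 1, 2, 5, 6]],
  [[1, 2, 2, 4, 5]]]

theorem check_1_3_2 : check [1, 3, 2] 15 cert_1_3_2 = true := by decide +kernel

def cert_1_5_1 : List (List (List ℕ)) := [[[1, 2, 2, 2, 7]],
  [[1, 2, 2, 3, 6]]]

theorem check_1_5_1 : check [1, 5, 1] 15 cert_1_5_1 = true := by decide +kernel

def cert_2_1_1_3 : List (List (List ℕ)) := [[[0, 0, 6, 9, 15]],
  [[0, 0, 7, 9, 14]],
  [[0, 1, 6, 8, 15]],
  [[0, 1, 6, 9, 14]],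
  [[1, 1, 6, 8, 14]],
  [[0, 0, 4, 11, 13]],
  [[0, 0, 5, 10, 13]],
  [[0, 0, 5, 11, 12]],
  [[0, 1, 4, 10, 13]],
  [[0, 1, 4, 11, 12]],
  [[0, 1, 5, 10, 12]],
  [[0, 2, 4, 9, 13]],
  [[0, 2, 5, 9, 12]],
  [[0, 3, 4, 8, 13]],
  [[0, 3, 4, 9, 12]],
  [[1, 1, 4, 10, 12]],
  [[1, 2, 4, 8, 13]],
  [[1, 2, 4, 9, 12]],
  [[1, 3, 4, 8, 12]],
  [[0, 2, 8, 9, 11]],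
  [[0, 2, 9, 9, 10]],
  [[0, 3, 8, 8, 11]],
  [[0, 3, 8, 9, 10]],
  [[1, 2, 8, 8, 11]],
  [[1, 2, 8, 9, 10]],
  [[1, 3, 8, 8, 10]],
  [[0, 4, 6, 9, 9]],
  [[0, 4, 7, 8, 9]],
  [[1, 4, 6, 8, 9]],
  [[1, 4, 7, 8, 8]],
  [[1, 4, 8, 9, 9]],
  [[1, 5, 8, 8, 9]],
  [[2, 3, 8, 8, 9]],
  [[3, 4, 5, 8, 8]]]

theorem check_2_1_1_3 : check [2, 1, 1, 3] 32 cert_2_1_1_3 = true := by decide +kernel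

def cert_2_3_2_2 : List (List (List ℕ)) := [[[0, 0, 1, 15, 15]],
  [[0, 0, 3, 13, 15]],
  [[0, 0, 5, 11, 15]],
  [[0, 0, 7, 9, 15]],
  [[0, 0, 7, 11, 13]],
  [[0, 1, 3, 12, 15]],
  [[0, 1, 4, 11, 15]],
  [[0, 1, 7, 8, 15]],
  [[0, 1, 7, 11, 12]],
  [[0, 3, 3, 12, 13]],
  [[0, 3, 4, 9, 15]],
  [[0, 3, 4, 11, 13]],
  [[0, 3, 5, 8, 15]],
  [[0, 3, 5, 11, 12]],
  [[0, 3, 6, 11, 11]],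
  [[0, 3, 7, 8, 13]],
  [[0, 3, 7, 9, 12]],
  [[0, 3, 7, 10, 11]],
  [[0, 5, 7, 8, 11]],
  [[0, 7, 7, 8, 9]],
  [[1, 3, 3, 12, 12]],
  [[1, 3, 4, 8, 15]],
  [[1, 3, 4, 11, 12]],
  [[1, 3, 7, 8, 12]],
  [[1, 4, 4, 11, 11]],
  [[1, 4, 7, 8, 11]],
  [[1, 7, 7, 8, 8]],
  [[3, 3, 4, 8, 13]],
  [[3, 3, 4, 9, 12]],
  [[3, 3, 5, 8, 12]],
  [[3, 4, 4, 9, 11]],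
  [[3, 4, 5, 8, 11]],
  [[3, 4, 7, 8, 9]],
  [[3, 5, 7, 8, 8]],
  [[0, 2, 2, 11, 15]],
  [[0, 2, 3, 10, 15]],
  [[0, 2, 7, 10, 11]],
  [[0, 3, 7, 10, 10]],
  [[2, 2, 3, 8, 15]],
  [[2, 2, 7, 8, 11]],
  [[2, 3, 7, 8, 10]],
  [[0, 2, 5, 6, 15]],
  [[0, 2, 6, 7, 13]],
  [[2, 2, 4, 5, 15]],
  [[2, 2, 4, 7, 13]],
  [[0, 1, 2, 13, 15]],
  [[0, 1, 5, 10, 15]],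
  [[0, 1, 6, 11, 13]],
  [[0, 1, 7, 10, 13]],
  [[0, 2, 5, 11, 13]],
  [[0, 2, 7, 9, 13]],
  [[0, 5, 7, 9, 10]],
  [[1, 2, 4, 9, 15]],
  [[1, 2, 4, 11, 13]],
  [[1, 2, 5, 8, 15]],
  [[1, 2, 7, 8, 13]],
  [[1, 5, 7, 8, 10]],
  [[1, 6, 7, 8, 9]],
  [[0, 2, 3, 11, 14]],
  [[1, 2, 2, 10, 15]],
  [[1, 2, 2, 11, 14]],
  [[2, 2, 2, 11, 13]],
  [[0, 5, 6, 7, 10]],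
  [[0, 6, 6, 7, 9]],
  [[1, 6, 6, 7, 8]],
  [[2, 5, 6, 7, 8]],
  [[0, 1, 3, 13, 14]],
  [[1, 1, 2, 13, 14]],
  [[0, 3, 6, 10, 11]],
  [[2, 3, 6, 8, 11]],
  [[2, 3, 4, 6, 13]],
  [[0, 3, 5, 10, 13]],
  [[0, 3, 6, 9, 13]],
  [[1, 3, 4, 10, 13]],
  [[1, 3, 6, 8, 13]],
  [[2, 3, 4, 9, 13]],
  [[2, 3, 5, 8, 13]],
  [[2, 2, 3, 9, 14]],
  [[2, 3, 4, 10, 11]],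
  [[2, 4, 5, 6, 11]],
  [[2, 4, 5, 7, 10]],
  [[1, 4, 5, 10, 11]],
  [[1, 4, 7, 9, 10]],
  [[2, 2, 6, 9, 11]],
  [[2, 2, 7, 9, 10]],
  [[2, 2, 5, 6, 13]],
  [[2, 2, 5, 7, 12]],
  [[1, 2, 5, 11, 12]],
  [[1, 2, 7, 9, 12]],
  [[1, 2, 6, 10, 11]],
  [[2, 2, 3, 10, 13]],
  [[1, 1, 6, 10, 13]],
  [[1, 2, 3, 12, 13]],
  [[1, 2, 5, 10, 13]],
  [[1, 2, 6, 9, 13]],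
  [[1, 3, 5, 10, 12], [1, 3, 6, 6, 12], [2, 3, 3, 10, 12], [1, 5, 3, 10, 12], [1, 6, 3, 10, 10], [1, 5, 3, 12, 10], [2, 3, 3, 12, 10], [1, 3, 5, 12, 10], [1, 3, 6, 6, 12], [1, 3, 6, 10, 10], [1, 5, 5, 10, 10]],
  [[2, 5, 6, 6, 9], [2, 5, 6, 6, 5], [2, 9, 6, 6, 5]],
  [[6, 9, 3, 4, 9], [6, 9, 5, 2, 9], [6, 9, 3, 1, 12], [6, 12, 3, 1, 9], [6, 10, 3, 2, 9], [6, 9, 3, 2, 10], [6, 10, 3, 1, 10]],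
  [[1, 5, 6, 6, 10]],
  [[1, 5, 6, 9, 10]],
  [[1, 3, 5, 10, 12], [1, 3, 6, 10, 10], [1, 3, 5, 12, 10], [2, 3, 5, 10, 10]],
  [[3, 4, 5, 9, 10]],
  [[2, 3, 6, 9, 10]],
  [[2, 3, 5, 6, 12]],
  [[3, 4, 5, 6, 10]],
  [[3, 4, 6, 6, 9]],
  [[1, 3, 5, 10, 12]]]

theorem check_2_3_2_2 : check [2, 3, 2, 2] 32 cert_2_3_2_2 = true := by decide +kernel

def cert_2_3_4_1 : List (List (List ℕ)) := [[[0, 3, 6, 7, 15]],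
  [[0, 3, 7, 7, 14]],
  [[0, 5, 7, 7, 12]],
  [[1, 4, 4, 7, 15]],
  [[1, 4, 7, 7, 12]],
  [[3, 4, 4, 5, 15]],
  [[3, 4, 4, 7, 13]],
  [[3, 4, 5, 7, 12]],
  [[3, 4, 6, 7, 11]],
  [[3, 4, 7, 7, 10]],
  [[3, 6, 7, 7, 8]],
  [[0, 3, 6, 6, 15]],
  [[0, 3, 6, 7, 14]],
  [[0, 6, 6, 7, 11]],
  [[1, 2, 6, 6, 15]],
  [[1, 2, 6, 7, 14]],
  [[1, 3, 6, 6, 14]],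
  [[1, 6, 6, 6, 11]],
  [[1, 6, 6, 7, 10]],
  [[2, 3, 4, 6, 15]],
  [[2, 3, 4, 7, 14]],
  [[2, 3, 6, 7, 12]],
  [[2, 4, 6, 7, 11]],
  [[2, 5, 6, 7, 10]],
  [[2, 6, 6, 7, 9]],
  [[3, 6, 6, 6, 9]],
  [[3, 6, 6, 7, 8]],
  [[4, 5, 6, 6, 7]],
  [[1, 5, 5, 6, 14]],
  [[1, 5, 6, 6, 13]],
  [[5, 5, 6, 6, 9]],
  [[2, 3, 5, 6, 14]],
  [[2, 3, 6, 6, 13]],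
  [[3, 5, 6, 6, 10]]]

theorem check_2_3_4_1 : check [2, 3, 4, 1] 32 cert_2_3_4_1 = true := by decide +kernel

def cert_2_5_1_2 : List (List (List ℕ)) := [[[1, 2, 2, 11, 15]],
  [[1, 2, 3, 10, 15]],
  [[1, 2, 3, 11, 14]],
  [[1, 2, 6, 11, 11]],
  [[1, 2, 7, 10, 11]],
  [[1, 3, 3, 10, 14]],
  [[1, 3, 6, 10, 11]],
  [[1, 3, 7, 10, 10]],
  [[3, 3, 5, 10, 10]]]

theorem check_2_5_1_2 : check [2, 5, 1, 2] 32 cert_2_5_1_2 = true := by decide +kernel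

def cert_2_5_3_1 : List (List (List ℕ)) := [[[1, 2, 6, 7, 15]],
  [[1, 2, 7, 7, 14]],
  [[1, 3, 6, 6, 15]],
  [[1, 3, 6, 7, 14]],
  [[1, 6, 6, 7, 11]],
  [[1, 6, 7, 7, 10]],
  [[3, 3, 5, 6, 14]],
  [[3, 5, 6, 6, 11]],
  [[3, 5, 6, 7, 10]]]

theorem check_2_5_3_1 : check [2, 5, 3, 1] 32 cert_2_5_3_1 = true := by decide +kernel

def cert_2_5_5 : List (List (List ℕ)) := [[[5, 6, 6, 7, 7]]]

theorem check_2_5_5 : check [2, 5, 5] 32 cert_2_5_5 = true := by decide +kernel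

def cert_4_2_4_1 : List (List (List ℕ)) := [[[0, 3, 5, 7, 15]],
  [[0, 3, 7, 7, 13]],
  [[1, 2, 5, 7, 15]],
  [[1, 2, 7, 7, 13]],
  [[1, 3, 5, 6, 15]],
  [[1, 3, 5, 7, 14]],
  [[1, 3, 6, 7, 13]],
  [[1, 3, 7, 7, 12]],
  [[2, 5, 7, 7, 9]],
  [[3, 5, 6, 7, 9]],
  [[3, 5, 7, 7, 8]],
  [[1, 5, 5, 5, 15]],
  [[1, 5, 5, 7, 13]],
  [[5, 5, 5, 7, 9]],
  [[2, 3, 5, 5, 15]],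
  [[2, 3, 5, 7, 13]],
  [[2, 5, 5, 7, 11]],
  [[3, 5, 5, 7, 10]],
  [[5, 5, 5, 6, 7]],
  [[3, 5, 5, 6, 11]],
  [[3, 5, 5, 5, 13]]]

theorem check_4_2_4_1 : check [4, 2, 4, 1] 32 cert_4_2_4_1 = true := by decide +kernel

def cert_4_1_2 : List (List (List ℕ)) := [[[0, 1, 1, 3, 7]],
  [[1, 1, 1, 2, 7]],
  [[1, 1, 1, 3, 6]],
  [[0, 1, 3, 3, 5], [0, 1, 3, 3, 3]],
  [[1, 1, 2, 3, 5], [1, 1, 2, 3, 3]],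
  [[1, 1, 2, 3, 5]]]

theorem check_4_1_2 : check [4, 1, 2] 14 cert_4_1_2 = true := by decide +kernel

def cert_4_5 : List (List (List ℕ)) := [[[1, 3, 3, 3, 3]]]

theorem check_4_5 : check [4, 5] 14 cert_4_5 = true := by decide +kernel

/-! ### The case analysis -/

theorem wv_nil {b : Fin 5 →₀ ℕ} (h : degA b = 0) (t : ℕ) : wVec b t = ([] : List ℕ).getD t 0 := by
  have hb : b = 0 := by
    ext i
    rw [degA, Finset.sum_eq_zero_iff] at h
    exact h i (Finset.mem_univ _)
  subst hb
  simp [wVec]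

theorem wv_cons {b : Fin 5 →₀ ℕ} {x : ℕ} {w : List ℕ} (h : wVec b 0 = x)
    (h' : ∀ t, wVec (half b) t = w.getD t 0) (t : ℕ) : wVec b t = (x :: w).getD t 0 := by
  cases t with
  | zero => exact h
  | succ t => rw [wVec_half, h' t]; rfl

theorem S5_mono {a : Fin 5 →₀ ℕ} (h : wVec a 0 = 5) : S5 (mono a) = mono (half a) := by
  have h1 : ∀ i, Odd (a i) := by
    rw [wVec_zero, Fin.sum_univ_five] at h
    intro i
    rw [Nat.odd_iff]
    fin_cases i <;> simp only [Fin.mk_zero, Fin.zero_eta, Fin.mk_one, Fin.reduceFinMk] <;> omega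
  have h2 : mono a = basisMonomials (Fin 5) (ZMod 2) a := by
    rw [coe_basisMonomials]; rfl
  rw [S5, h2, Module.Basis.constr_basis, if_pos h1]
  rfl

theorem good_deg31 {a : Fin 5 →₀ ℕ} (h0 : wVec a 0 = 5) (h1 : degA a = 67)
    (h4 : IsHit 5 31 (S5 (mono a))) : Good a := by
  apply Good.of_half
  have := degA_half a
  rw [S5_mono h0] at h4
  have h := isHit_mem_Hs h4
  rw [show 31 = degA (half a) by omega] at h
  exact Submodule.mem_sup_left h

/-- Weight sequences of degree `15` starting with `1` or degree `32` starting with `2`. -/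
theorem tree_a {b : Fin 5 →₀ ℕ} (hd : degA b = 32) (hb : wVec b 0 = 2) :
    Good b ∨ ∀ t, wVec b t = [2, 1, 1, 1, 1].getD t 0 := by
  have e0 := degA_half b
  have e1 := degA_half (half b)
  have e2 := degA_half (half (half b))
  have e3 := degA_half (half (half (half b)))
  have e4 := degA_half (half (half (half (half b))))
  have l1 := wVec_le (half b) 0
  have l2 := wVec_le (half (half b)) 0
  have l3 := wVec_le (half (half (half b))) 0
  have l4 := wVec_le (half (half (half (half b)))) 0
  have c1 : wVec (half b) 0 = 1 ∨ wVec (half b) 0 = 3 ∨ wVec (half b) 0 = 5 := by omega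
  rcases c1 with c1 | c1 | c1
  · have c2 : wVec (half (half b)) 0 = 1 ∨ wVec (half (half b)) 0 = 3 ∨
      wVec (half (half b)) 0 = 5 := by omega
    rcases c2 with c2 | c2 | c2
    · have c3 : wVec (half (half (half b))) 0 = 1 ∨ wVec (half (half (half b))) 0 = 3 := by omega
      rcases c3 with c3 | c3
      · right
        exact wv_cons hb (wv_cons c1 (wv_cons c2 (wv_cons c3 (wv_cons (by omega)
          (wv_nil (by omega))))))
      · left
        exact good_of_check check_2_1_1_3 hd (wv_cons hb (wv_cons c1 (wv_cons c2 (wv_cons c3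
          (wv_nil (by omega))))))
    · left
      have c3 : wVec (half (half (half b))) 0 = 0 ∨ wVec (half (half (half b))) 0 = 2 := by omega
      rcases c3 with c3 | c3
      · exact (good_even c3 (by omega)).of_half.of_half.of_half
      · exact (good_of_check check_1_3_2 (by omega) (wv_cons c1 (wv_cons c2 (wv_cons c3
          (wv_nil (by omega)))))).of_half
    · left
      exact (good_of_check check_1_5_1 (by omega) (wv_cons c1 (wv_cons c2 (wv_cons (by omega)
        (wv_nil (by omega)))))).of_half
  · left
    have c2 : wVec (half (half b)) 0 = 0 ∨ wVec (half (half b)) 0 = 2 ∨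
      wVec (half (half b)) 0 = 4 := by omega
    rcases c2 with c2 | c2 | c2
    · exact (good_even c2 (by omega)).of_half.of_half
    · have c3 : wVec (half (half (half b))) 0 = 0 ∨ wVec (half (half (half b))) 0 = 2 := by omega
      rcases c3 with c3 | c3
      · exact (good_even c3 (by omega)).of_half.of_half.of_half
      · exact good_of_check check_2_3_2_2 hd (wv_cons hb (wv_cons c1 (wv_cons c2 (wv_cons c3
          (wv_nil (by omega))))))
    · exact good_of_check check_2_3_4_1 hd (wv_cons hb (wv_cons c1 (wv_cons c2
        (wv_cons (by omega) (wv_nil (by omega))))))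
  · left
    have c2 : wVec (half (half b)) 0 = 1 ∨ wVec (half (half b)) 0 = 3 ∨
      wVec (half (half b)) 0 = 5 := by omega
    rcases c2 with c2 | c2 | c2
    · have c3 : wVec (half (half (half b))) 0 = 0 ∨ wVec (half (half (half b))) 0 = 2 := by omega
      rcases c3 with c3 | c3
      · exact (good_even c3 (by omega)).of_half.of_half.of_half
      · exact good_of_check check_2_5_1_2 hd (wv_cons hb (wv_cons c1 (wv_cons c2 (wv_cons c3
          (wv_nil (by omega))))))
    · exact good_of_check check_2_5_3_1 hd (wv_cons hb (wv_cons c1 (wv_cons c2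
        (wv_cons (by omega) (wv_nil (by omega))))))
    · exact good_of_check check_2_5_5 hd (wv_cons hb (wv_cons c1 (wv_cons c2
        (wv_nil (by omega)))))

theorem tree_b {b : Fin 5 →₀ ℕ} (hd : degA b = 32) (hb : wVec b 0 = 4) :
    Good b ∨ (∀ t, wVec b t = [4, 2, 2, 2].getD t 0) ∨ ∀ t, wVec b t = [4, 4, 3, 1].getD t 0 := by
  have e0 := degA_half b
  have e1 := degA_half (half b)
  have e2 := degA_half (half (half b))
  have e3 := degA_half (half (half (half b)))
  have l1 := wVec_le (half b) 0
  have l2 := wVec_le (half (half b)) 0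
  have l3 := wVec_le (half (half (half b))) 0
  have c1 : wVec (half b) 0 = 0 ∨ wVec (half b) 0 = 2 ∨ wVec (half b) 0 = 4 := by omega
  rcases c1 with c1 | c1 | c1
  · left
    exact (good_even c1 (by omega)).of_half
  · have c2 : wVec (half (half b)) 0 = 0 ∨ wVec (half (half b)) 0 = 2 ∨
      wVec (half (half b)) 0 = 4 := by omega
    rcases c2 with c2 | c2 | c2
    · left
      exact (good_even c2 (by omega)).of_half.of_half
    · have c3 : wVec (half (half (half b))) 0 = 0 ∨ wVec (half (half (half b))) 0 = 2 := by omega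
      rcases c3 with c3 | c3
      · left
        exact (good_even c3 (by omega)).of_half.of_half.of_half
      · right; left
        exact wv_cons hb (wv_cons c1 (wv_cons c2 (wv_cons c3 (wv_nil (by omega)))))
    · left
      exact good_of_check check_4_2_4_1 hd (wv_cons hb (wv_cons c1 (wv_cons c2
        (wv_cons (by omega) (wv_nil (by omega))))))
  · have c2 : wVec (half (half b)) 0 = 1 ∨ wVec (half (half b)) 0 = 3 ∨
      wVec (half (half b)) 0 = 5 := by omega
    rcases c2 with c2 | c2 | c2
    · left
      have c3 : wVec (half (half (half b))) 0 = 0 ∨ wVec (half (half (half b))) 0 = 2 := by omega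
      rcases c3 with c3 | c3
      · exact (good_even c3 (by omega)).of_half.of_half.of_half
      · exact (good_of_check check_4_1_2 (by omega) (wv_cons c1 (wv_cons c2 (wv_cons c3
          (wv_nil (by omega)))))).of_half
    · right; right
      exact wv_cons hb (wv_cons c1 (wv_cons c2 (wv_cons (by omega) (wv_nil (by omega)))))
    · left
      exact (good_of_check check_4_5 (by omega) (wv_cons c1 (wv_cons c2
        (wv_nil (by omega))))).of_half

/-- if `u = x^a` is an admissible monomial of degree `67` in `P_5` with all
exponents positive and `S_5(u)` is hit, then `ω(u)` is one of `(3,4,2,2,2)`,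
`(3,4,4,3,1)`, `(3,2,1,1,1,1)` (followed by zeros). -/
theorem statement3 (a : Fin 5 →₀ ℕ) (h1 : degA a = 67) (h2 : ∀ i, 0 < a i)
    (h3 : Admissible a) (h4 : IsHit 5 31 (S5 (mono a))) :
    wVec a = (fun t => [3, 4, 2, 2, 2].getD t 0) ∨
    wVec a = (fun t => [3, 4, 4, 3, 1].getD t 0) ∨
    wVec a = (fun t => [3, 2, 1, 1, 1, 1].getD t 0) := by
  have e0 := degA_half a
  have l0 := wVec_le a 0
  have l1 := wVec_le (half a) 0
  have e1 := degA_half (half a)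
  have c0 : wVec a 0 = 1 ∨ wVec a 0 = 3 ∨ wVec a 0 = 5 := by omega
  rcases c0 with c0 | c0 | c0
  · exact absurd h3 (good_chi c0 h1).not_admissible
  · have c1 : wVec (half a) 0 = 0 ∨ wVec (half a) 0 = 2 ∨ wVec (half a) 0 = 4 := by omega
    rcases c1 with c1 | c1 | c1
    · exact absurd h3 (good_even c1 (by omega)).of_half.not_admissible
    · rcases tree_a (by omega) c1 with h | h
      · exact absurd h3 h.of_half.not_admissible
      · exact Or.inr (Or.inr (funext (wv_cons c0 h)))
    · rcases tree_b (by omega) c1 with h | h | h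
      · exact absurd h3 h.of_half.not_admissible
      · exact Or.inl (funext (wv_cons c0 h))
      · exact Or.inr (Or.inl (funext (wv_cons c0 h)))
  · exact absurd h3 (good_deg31 c0 h1 h4).not_admissible

end
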